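/- Let X ⊆ ℤ^d be a finite set of vectors with cone(X) ≠ span(X) and norm bound ‖x‖ ≤ M for all x ∈ X (max norm), and let r = dim(span(X)). Then there exists a non-zero n ∈ ℤ^d with ⟨n,x⟩ ≥ 0 for all x ∈ X, cone({x ∈ X : ⟨n,x⟩ = 0}) = span({x ∈ X : ⟨n,x⟩ = 0}), and ‖n‖ ≤ (d+1)·(rM)^r. -/

import Mathlib

def cone {d : ℕ} (X : Set (Fin d → ℚ)) : Set (Fin d → ℚ) :=
  {y | ∃ (k : ℕ) (c : Fin k → ℚ) (v : Fin k → (Fin d → ℚ)),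
    (∀ i, 0 ≤ c i) ∧ (∀ i, v i ∈ X) ∧ y = ∑ i, c i • v i}

def coeVec {d : ℕ} (v : Fin d → ℤ) : Fin d → ℚ := fun i => (v i : ℚ)

open PointedCone in
/-- **Farkas' lemma**: a vector outside a finitely generated cone is separated from it
by a linear functional. -/
theorem exists_dual_nonneg_of_notMem_hull {V ι : Type*} [AddCommGroup V] [Module ℚ V]
    (s : Finset ι) (v : ι → V) (b : V) (hb : b ∉ hull ℚ (v '' s)) :
    ∃ φ : Module.Dual ℚ V, (∀ i ∈ s, 0 ≤ φ (v i)) ∧ φ b < 0 := by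
  classical
  induction s using Finset.induction_on generalizing v b with
  | empty =>
    have hb0 : b ∉ (⊥ : Submodule ℚ V) := by simpa using hb
    obtain ⟨f, hf, -⟩ := Submodule.exists_le_ker_of_notMem hb0
    rcases lt_or_gt_of_ne hf with h | h
    · exact ⟨f, by simp, h⟩
    · exact ⟨-f, by simp, by simpa using h⟩
  | insert a s ha ih =>
    have hsub : hull ℚ (v '' s) ≤ hull ℚ (v '' (insert a s : Finset ι)) :=
      Submodule.span_mono (Set.image_mono (by simp))
    have hmem : ∀ i ∈ insert a s, v i ∈ hull ℚ (v '' (insert a s : Finset ι)) := fun i hi =>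
      subset_hull ⟨i, by exact_mod_cast hi, rfl⟩
    obtain ⟨φ, hφ, hφb⟩ := ih v b fun h => hb (hsub h)
    by_cases hφa : 0 ≤ φ (v a)
    · exact ⟨φ, by simpa [hφa] using hφ, hφb⟩
    push Not at hφa
    let π : V →ₗ[ℚ] V := LinearMap.id - ((φ (v a))⁻¹ • φ).smulRight (v a)
    have hπ : ∀ x, π x = x - ((φ (v a))⁻¹ * φ x) • v a := fun x => by simp [π]
    have hπa : π (v a) = 0 := by rw [hπ, inv_mul_cancel₀ hφa.ne, one_smul, sub_self]
    have hle : hull ℚ ((π ∘ v) '' s) ≤ hull ℚ (v '' (insert a s : Finset ι)) := by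
      refine Submodule.span_le.2 ?_
      rintro _ ⟨i, hi, rfl⟩
      have hi' : i ∈ s := by exact_mod_cast hi
      have hc : 0 ≤ -((φ (v a))⁻¹ * φ (v i)) :=
        neg_nonneg.2 (mul_nonpos_of_nonpos_of_nonneg (inv_nonpos.2 hφa.le) (hφ i hi'))
      have := add_mem (hmem i (by simp [hi'])) (smul_mem _ hc (hmem a (by simp)))
      simpa [hπ, sub_eq_add_neg] using this
    have hπb : π b ∉ hull ℚ ((π ∘ v) '' s) := fun h => by
      have hc : 0 ≤ (φ (v a))⁻¹ * φ b := mul_nonneg_of_nonpos_of_nonpos (inv_nonpos.2 hφa.le) hφb.le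
      have := add_mem (hle h) (smul_mem _ hc (hmem a (by simp)))
      rw [hπ, sub_add_cancel] at this
      exact hb this
    obtain ⟨ψ, hψ, hψb⟩ := ih (π ∘ v) (π b) hπb
    refine ⟨ψ ∘ₗ π, fun i hi => ?_, hψb⟩
    rcases Finset.mem_insert.1 hi with rfl | hi
    · simp [hπa]
    · exact hψ i hi

open PointedCone in
/-- A functional that is nonnegative on `X` and vanishes on no vector of `X` outside
the lineality space of the cone generated by `X`. -/
theorem exists_dual_nonneg_neg_mem_hull {V : Type*} [AddCommGroup V] [Module ℚ V]
    (X : Finset V) :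
    ∃ φ : Module.Dual ℚ V, (∀ x ∈ X, 0 ≤ φ x) ∧
      ∀ x ∈ X, φ x = 0 → -x ∈ hull ℚ (X : Set V) := by
  have key : ∀ y : V, ∃ φ : Module.Dual ℚ V, (∀ x ∈ X, 0 ≤ φ x) ∧
      (-y ∉ hull ℚ (X : Set V) → 0 < φ y) := fun y => by
    by_cases hy : -y ∈ hull ℚ (X : Set V)
    · exact ⟨0, by simp, fun h => absurd hy h⟩
    · obtain ⟨φ, hφ, hφy⟩ := exists_dual_nonneg_of_notMem_hull X id (-y) (by simpa using hy)
      exact ⟨φ, hφ, fun _ => by simpa using hφy⟩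
  choose φ hφ hφy using key
  refine ⟨∑ y ∈ X, φ y, fun x hx => ?_, fun x hx h0 => ?_⟩
  · rw [LinearMap.sum_apply]
    exact Finset.sum_nonneg fun y _ => hφ y x hx
  · by_contra hx'
    rw [LinearMap.sum_apply, Finset.sum_eq_zero_iff_of_nonneg fun y _ => hφ y x hx] at h0
    exact (hφy x hx').ne' (h0 x hx)

open PointedCone in
theorem mem_hull_zeros_of_dual_eq_zero {V : Type*} [AddCommGroup V] [Module ℚ V]
    {X : Set V} {φ : Module.Dual ℚ V} (hφ : ∀ x ∈ X, 0 ≤ φ x) {y : V}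
    (hy : y ∈ hull ℚ X) (h0 : φ y = 0) : y ∈ hull ℚ {x ∈ X | φ x = 0} := by
  suffices 0 ≤ φ y ∧ (φ y = 0 → y ∈ hull ℚ {x ∈ X | φ x = 0}) from this.2 h0
  clear h0
  induction hy using Submodule.span_induction with
  | mem x hx => exact ⟨hφ x hx, fun h => subset_hull ⟨hx, h⟩⟩
  | zero => simp
  | add x y _ _ hx hy =>
    rw [map_add]
    exact ⟨add_nonneg hx.1 hy.1, fun h => by
      obtain ⟨h1, h2⟩ := (add_eq_zero_iff_of_nonneg hx.1 hy.1).1 h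
      exact add_mem (hx.2 h1) (hy.2 h2)⟩
  | smul c x _ hx =>
    have hc : φ (c • x) = c * φ x := map_smul φ (c : ℚ) x
    rw [hc]
    refine ⟨mul_nonneg c.2 hx.1, fun h => ?_⟩
    rcases mul_eq_zero.1 h with h | h
    · rw [show c = 0 from Subtype.ext h, zero_smul]
      exact zero_mem _
    · exact Submodule.smul_mem _ c (hx.2 h)

theorem cone_eq_hull {d : ℕ} (X : Set (Fin d → ℚ)) : cone X = PointedCone.hull ℚ X := by
  ext y
  rw [SetLike.mem_coe, Submodule.mem_span_set']
  constructor
  · rintro ⟨k, c, v, hc, hv, rfl⟩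
    exact ⟨k, fun i => ⟨c i, hc i⟩, fun i => ⟨v i, hv i⟩, rfl⟩
  · rintro ⟨k, c, v, rfl⟩
    exact ⟨k, fun i => c i, fun i => v i, fun i => (c i).2, fun i => (v i).2, rfl⟩

open PointedCone in
theorem hull_eq_span_of_neg_mem {V : Type*} [AddCommGroup V] [Module ℚ V] {Z : Set V}
    (hZ : ∀ x ∈ Z, -x ∈ hull ℚ Z) : (hull ℚ Z : Set V) = Submodule.span ℚ Z := by
  have hneg : ∀ x ∈ hull ℚ Z, -x ∈ hull ℚ Z := fun x hx => by
    induction hx using Submodule.span_induction with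
    | mem x hx => exact hZ x hx
    | zero => simp
    | add x y _ _ hx hy =>
      rw [neg_add]
      exact add_mem hx hy
    | smul c x _ hx =>
      rw [← smul_neg]
      exact Submodule.smul_mem _ c hx
  refine Set.Subset.antisymm (hull_le_span ℚ Z) fun x hx => ?_
  induction hx using Submodule.span_induction with
  | mem x hx => exact subset_hull hx
  | zero => exact zero_mem _
  | add x y _ _ hx hy => exact add_mem hx hy
  | smul c x _ hx =>
    rcases le_total 0 c with hc | hc
    · exact smul_mem _ hc hx
    · have := smul_mem _ (neg_nonneg.2 hc) (hneg x hx)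
      rwa [neg_smul_neg] at this

/-- Among the functionals taking on each vector of `X` either the value `0` or a value at least
`1`, with prescribed zeros, there is a vertex: one determined by its values in `{0, 1}`. -/
theorem exists_dual_vertex {V : Type*} [AddCommGroup V] [Module ℚ V] (X : Finset V)
    (φ : Module.Dual ℚ V) (hφ : ∀ x ∈ X, φ x = 0 ∨ 1 ≤ φ x) :
    ∃ φ' : Module.Dual ℚ V, (∀ x ∈ X, φ' x = 0 ∨ 1 ≤ φ' x) ∧
      (∀ x ∈ X, φ' x = 0 ↔ φ x = 0) ∧
      ∀ x ∈ X, x ∈ Submodule.span ℚ {y | y ∈ X ∧ (φ' y = 0 ∨ φ' y = 1)} := by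
  induction hn : (X.filter (1 < φ ·)).card using Nat.strong_induction_on generalizing φ with
  | _ n ih =>
  by_cases hspan : ∀ x ∈ X, x ∈ Submodule.span ℚ {y | y ∈ X ∧ (φ y = 0 ∨ φ y = 1)}
  · exact ⟨φ, hφ, fun _ _ => Iff.rfl, hspan⟩
  push Not at hspan
  obtain ⟨x₀, hx₀, hx₀span⟩ := hspan
  obtain ⟨ψ, hψx₀, hψ⟩ : ∃ ψ : Module.Dual ℚ V, ψ x₀ < 0 ∧
      ∀ x ∈ X, φ x = 0 ∨ φ x = 1 → ψ x = 0 := by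
    obtain ⟨f, hf, hker⟩ := Submodule.exists_le_ker_of_notMem hx₀span
    have hf0 : ∀ x ∈ X, φ x = 0 ∨ φ x = 1 → f x = 0 := fun x hx h =>
      hker (Submodule.subset_span ⟨hx, h⟩)
    rcases lt_or_gt_of_ne hf with h | h
    · exact ⟨f, h, hf0⟩
    · exact ⟨-f, by simpa using h, fun x hx h => by simp [hf0 x hx h]⟩
  obtain ⟨x₁, hx₁, hmin⟩ := Finset.exists_min_image (X.filter (ψ · < 0))
    (fun x => (φ x - 1) / -ψ x) ⟨x₀, by simp [hx₀, hψx₀]⟩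
  simp only [Finset.mem_filter, and_imp] at hx₁ hmin
  obtain ⟨hx₁, hψx₁⟩ := hx₁
  have hgt : ∀ x ∈ X, ψ x ≠ 0 → 1 < φ x := fun x hx h => by
    rcases hφ x hx with h0 | h1
    · exact absurd (hψ x hx (Or.inl h0)) h
    · exact lt_of_le_of_ne h1 fun h1 => h (hψ x hx (Or.inr h1.symm))
  set t := (φ x₁ - 1) / -ψ x₁ with ht
  have htpos : 0 < t := div_pos (sub_pos.2 (hgt x₁ hx₁ hψx₁.ne)) (neg_pos.2 hψx₁)
  let φ₁ : Module.Dual ℚ V := φ + t • ψ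
  have hφ₁ : ∀ x, φ₁ x = φ x + t * ψ x := fun x => by simp [φ₁]
  have hφ₁ge : ∀ x ∈ X, 1 ≤ φ x → 1 ≤ φ₁ x := fun x hx h1 => by
    rw [hφ₁]
    rcases le_or_gt 0 (ψ x) with h | h
    · linarith [mul_nonneg htpos.le h]
    · have := (le_div_iff₀ (neg_pos.2 h)).1 (hmin x hx h)
      linarith
  have hφ₁zero : ∀ x ∈ X, φ x = 0 → φ₁ x = 0 := fun x hx h => by
    rw [hφ₁, h, hψ x hx (Or.inl h), mul_zero, add_zero]
  have hφ₁x₁ : φ₁ x₁ = 1 := by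
    rw [hφ₁, ht]
    field_simp [hψx₁.ne]
    ring
  have hlt : (X.filter (1 < φ₁ ·)).card < n := by
    rw [← hn]
    refine Finset.card_lt_card (Finset.ssubset_iff_of_subset ?_ |>.2 ⟨x₁, ?_, ?_⟩)
    · intro x hx
      simp only [Finset.mem_filter] at hx ⊢
      refine ⟨hx.1, ?_⟩
      by_cases h : ψ x = 0
      · simpa [hφ₁, h] using hx.2
      · exact hgt x hx.1 h
    · simp [hx₁, hgt x₁ hx₁ hψx₁.ne]
    · simp [hφ₁x₁]
  obtain ⟨φ', h1, h2, h3⟩ := ih _ hlt φ₁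
    (fun x hx => (hφ x hx).imp (hφ₁zero x hx) (hφ₁ge x hx)) rfl
  refine ⟨φ', h1, fun x hx => (h2 x hx).trans ⟨fun h => ?_, hφ₁zero x hx⟩, h3⟩
  refine (hφ x hx).resolve_right fun h' => ?_
  linarith [hφ₁ge x hx h']

/-- The functional can be rescaled so that its positive values on `X` are at least `1`. -/
theorem exists_dual_one_le {V : Type*} [AddCommGroup V] [Module ℚ V] (X : Finset V)
    (φ : Module.Dual ℚ V) (hφ : ∀ x ∈ X, 0 ≤ φ x) :
    ∃ φ' : Module.Dual ℚ V, (∀ x ∈ X, φ' x = 0 ∨ 1 ≤ φ' x) ∧ ∀ x ∈ X, φ' x = 0 ↔ φ x = 0 := by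
  have hpos : 0 < 1 + ∑ x ∈ X, (φ x)⁻¹ :=
    add_pos_of_pos_of_nonneg one_pos (Finset.sum_nonneg fun x hx => inv_nonneg.2 (hφ x hx))
  refine ⟨(1 + ∑ x ∈ X, (φ x)⁻¹) • φ, fun x hx => ?_, fun x hx => by simp [hpos.ne']⟩
  rcases (hφ x hx).eq_or_lt with h | h
  · simp [← h]
  · right
    have := Finset.single_le_sum (fun y hy => inv_nonneg.2 (hφ y hy)) hx
    calc 1 = (φ x)⁻¹ * φ x := (inv_mul_cancel₀ h.ne').symm
      _ ≤ (1 + ∑ x ∈ X, (φ x)⁻¹) * φ x := by gcongr; linarith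

/-- A matrix with linearly independent rows has a nonsingular maximal square submatrix. -/
theorem exists_submatrix_det_ne_zero {r d : ℕ} (B : Matrix (Fin r) (Fin d) ℚ)
    (hB : LinearIndependent ℚ B.row) :
    ∃ σ : Fin r → Fin d, Function.Injective σ ∧ (B.submatrix id σ).det ≠ 0 := by
  have hrank := hB.rank_matrix
  rw [B.rank_eq_finrank_span_cols, Fintype.card_fin] at hrank
  have hex := Submodule.exists_fun_fin_finrank_span_eq ℚ (Set.range B.col)
  rw [hrank] at hex
  obtain ⟨f, hf, -, hli⟩ := hex
  choose σ hσ using hf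
  refine ⟨σ, fun i j hij => hli.injective (by rw [← hσ, ← hσ, hij]), ?_⟩
  have hcol : (B.submatrix id σ).col = f := by
    ext i j
    exact congrFun (hσ i) j
  rw [← hcol, Matrix.linearIndependent_cols_iff_isUnit, Matrix.isUnit_iff_isUnit_det] at hli
  exact hli.ne_zero

/-- Cramer's rule: an integral solution, of bounded size, of a scaled underdetermined system of
linear equations with independent left-hand sides. -/
theorem exists_bounded_integral_solution {r d : ℕ} (z : Fin r → Fin d → ℤ)
    (hz : LinearIndependent ℚ fun j => coeVec (z j)) (b : Fin r → ℤ) (M : ℤ) (hM0 : 0 ≤ M)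
    (hM : ∀ j k, |z j k| ≤ M) (hb : ∀ j, |b j| ≤ M) :
    ∃ (n : Fin d → ℤ) (D : ℤ), 0 < D ∧ (∀ j, ∑ k, n k * z j k = D * b j) ∧
      ∀ k, |n k| ≤ r.factorial * M ^ r := by
  obtain ⟨σ, hσ, hdet⟩ := exists_submatrix_det_ne_zero (Matrix.of fun j => coeVec (z j)) hz
  let A : Matrix (Fin r) (Fin r) ℤ := Matrix.of fun j i => z j (σ i)
  have hA : A.det ≠ 0 := fun h => hdet <| by
    have : ((Matrix.of fun j => coeVec (z j)).submatrix id σ) = A.map (Int.castRingHom ℚ) := rfl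
    rw [this, ← RingHom.mapMatrix_apply, ← RingHom.map_det, h, map_zero]
  let m : Fin r → ℤ := A.det.sign • A.cramer b
  have hm : ∀ i, |m i| ≤ r.factorial * M ^ r := fun i => by
    have h1 : |m i| = |(A.updateCol i b).det| := by
      simp [m, abs_mul, Matrix.cramer_apply, Int.abs_sign_of_ne_zero hA]
    have h2 := Matrix.det_le (A := A.updateCol i b) (abv := AbsoluteValue.abs) (x := M)
      fun j k => by
        rcases eq_or_ne k i with rfl | hk
        · simpa using hb j
        · simpa [hk, A] using hM j (σ k)
    simpa [h1] using h2
  have hAm : A.mulVec m = |A.det| • b := by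
    rw [Matrix.mulVec_smul, Matrix.mulVec_cramer, smul_smul, Int.sign_mul_self_eq_abs]
  refine ⟨Function.extend σ m 0, |A.det|, abs_pos.2 hA, fun j => ?_, fun k => ?_⟩
  · rw [← smul_eq_mul, ← Pi.smul_apply, ← hAm, Matrix.mulVec, dotProduct]
    refine (Finset.sum_of_injOn σ hσ.injOn (by simp) (fun k _ hk => ?_) fun i _ => ?_).symm
    · rw [Function.extend_apply' _ _ _ (by simpa using hk), Pi.zero_apply, zero_mul]
    · rw [hσ.extend_apply, mul_comm]
      rfl
  · by_cases hk : ∃ i, σ i = k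
    · obtain ⟨i, rfl⟩ := hk
      rw [hσ.extend_apply]
      exact hm i
    · rw [Function.extend_apply' _ _ _ hk, Pi.zero_apply, abs_zero]
      positivity

theorem stmt1 (d : ℕ) (X : Finset (Fin d → ℤ)) (M : ℤ)
    (hM : ∀ x ∈ X, ∀ i, |x i| ≤ M)
    (h : cone (coeVec '' (X : Set (Fin d → ℤ)))
        ≠ (Submodule.span ℚ (coeVec '' (X : Set (Fin d → ℤ))) : Set (Fin d → ℚ))) :
    ∃ n : Fin d → ℤ, n ≠ 0 ∧ (∀ x ∈ X, 0 ≤ ∑ i, n i * x i) ∧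
      (cone (coeVec '' {x : Fin d → ℤ | x ∈ X ∧ ∑ i, n i * x i = 0})
        = (Submodule.span ℚ (coeVec '' {x : Fin d → ℤ | x ∈ X ∧ ∑ i, n i * x i = 0}) :
            Set (Fin d → ℚ))) ∧
      (∀ i, |n i| ≤ ((d : ℤ) + 1) *
        (((Module.finrank ℚ (Submodule.span ℚ (coeVec '' (X : Set (Fin d → ℤ))))) : ℤ) * M) ^
          (Module.finrank ℚ (Submodule.span ℚ (coeVec '' (X : Set (Fin d → ℤ)))))) := by
  classical
  set S : Finset (Fin d → ℚ) := X.image coeVec with hS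
  have hSX : (coeVec '' (X : Set (Fin d → ℤ))) = S := by simp [hS]
  rw [hSX] at h ⊢
  have hmemS : ∀ x ∈ X, coeVec x ∈ S := fun x hx => Finset.mem_image_of_mem _ hx
  obtain ⟨φ₀, hφ₀, hlin₀⟩ := exists_dual_nonneg_neg_mem_hull S
  obtain ⟨φ₁, hφ₁, hφ₁0⟩ := exists_dual_one_le S φ₀ hφ₀
  obtain ⟨φ, hφ, hφ0, hspan⟩ := exists_dual_vertex S φ₁ hφ₁
  have hφnn : ∀ x ∈ S, 0 ≤ φ x := fun x hx => by
    rcases hφ x hx with h | h <;> linarith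
  have hlin : ∀ x ∈ S, φ x = 0 → -x ∈ PointedCone.hull ℚ (S : Set (Fin d → ℚ)) :=
    fun x hx h => hlin₀ x hx ((hφ₁0 x hx).1 ((hφ0 x hx).1 h))
  obtain ⟨x₀, hx₀, hφx₀⟩ : ∃ x ∈ X, φ (coeVec x) ≠ 0 := by
    by_contra! hall
    refine h ?_
    rw [cone_eq_hull, hull_eq_span_of_neg_mem]
    intro x hx
    obtain ⟨y, hy, rfl⟩ := Finset.mem_image.1 hx
    exact hlin _ hx (hall y hy)
  have hM1 : 1 ≤ M := by
    have hne : x₀ ≠ 0 := by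
      rintro rfl
      exact hφx₀ (by rw [show coeVec (0 : Fin d → ℤ) = 0 by ext; simp [coeVec], map_zero])
    obtain ⟨i, hi⟩ := Function.ne_iff.1 hne
    exact (Int.one_le_abs hi).trans (hM x₀ hx₀ i)
  set T : Set (Fin d → ℚ) := {y | y ∈ S ∧ (φ y = 0 ∨ φ y = 1)}
  have hT : Submodule.span ℚ T = Submodule.span ℚ (S : Set (Fin d → ℚ)) :=
    le_antisymm (Submodule.span_mono fun y hy => hy.1) (Submodule.span_le.2 hspan)
  have hex := Submodule.exists_fun_fin_finrank_span_eq ℚ T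
  rw [hT] at hex
  set r := Module.finrank ℚ (Submodule.span ℚ (S : Set (Fin d → ℚ)))
  obtain ⟨f, hf, hfspan, hfli⟩ := hex
  choose z hzX hz using fun j => Finset.mem_image.1 (hf j).1
  have hb : ∀ j, ∃ b : ℤ, |b| ≤ M ∧ φ (f j) = b := fun j => by
    rcases (hf j).2 with h | h
    · exact ⟨0, by simp; omega, by simp [h]⟩
    · exact ⟨1, by simpa using hM1, by simp [h]⟩
  choose b hbM hb using hb
  obtain ⟨n, D, hD, hn, hnM⟩ := exists_bounded_integral_solution z (by simpa only [hz] using hfli)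
    b M (by omega) (fun j => hM _ (hzX j)) hbM
  have hnφ : ∀ x ∈ X, ((∑ i, n i * x i : ℤ) : ℚ) = D * φ (coeVec x) := fun x hx => by
    let ν : Module.Dual ℚ (Fin d → ℚ) := ∑ i, (n i : ℚ) • LinearMap.proj i
    have hν : ∀ x : Fin d → ℤ, ν (coeVec x) = ((∑ i, n i * x i : ℤ) : ℚ) := fun x => by
      simp [ν, coeVec]
    have heq : Set.EqOn ν ((D : ℚ) • φ : Module.Dual ℚ (Fin d → ℚ)) (Set.range f) := by
      rintro _ ⟨j, rfl⟩
      rw [LinearMap.smul_apply, hb, ← hz, hν, hn]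
      simp
    rw [← hν]
    refine LinearMap.eqOn_span heq ?_
    rw [hfspan]
    exact Submodule.subset_span (hmemS x hx)
  have hD' : (0 : ℚ) < D := by exact_mod_cast hD
  have hzero : ∀ x ∈ X, ∑ i, n i * x i = 0 ↔ φ (coeVec x) = 0 := fun x hx => by
    rw [← Int.cast_eq_zero (α := ℚ), hnφ x hx, mul_eq_zero, or_iff_right hD'.ne']
  refine ⟨n, ?_, fun x hx => ?_, ?_, fun i => (hnM i).trans ?_⟩
  · rintro rfl
    exact hφx₀ ((hzero x₀ hx₀).1 (by simp))
  · have := mul_nonneg hD'.le (hφnn _ (hmemS x hx))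
    rw [← hnφ x hx] at this
    exact_mod_cast this
  · have hZ : coeVec '' {x : Fin d → ℤ | x ∈ X ∧ ∑ i, n i * x i = 0}
        = {y ∈ (S : Set (Fin d → ℚ)) | φ y = 0} := by
      ext y
      constructor
      · rintro ⟨x, ⟨hx, h0⟩, rfl⟩
        exact ⟨hmemS x hx, (hzero x hx).1 h0⟩
      · rintro ⟨hy, h0⟩
        obtain ⟨x, hx, rfl⟩ := Finset.mem_image.1 hy
        exact ⟨x, ⟨hx, (hzero x hx).2 h0⟩, rfl⟩
    rw [hZ, cone_eq_hull, hull_eq_span_of_neg_mem]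
    rintro y ⟨hy, h0⟩
    exact mem_hull_zeros_of_dual_eq_zero hφnn (hlin y hy h0) (by rw [map_neg, h0, neg_zero])
  · have hfact : (r.factorial : ℤ) ≤ (r : ℤ) ^ r := by exact_mod_cast r.factorial_le_pow
    have hMr : (0 : ℤ) ≤ M ^ r := by positivity
    calc (r.factorial : ℤ) * M ^ r ≤ (r : ℤ) ^ r * M ^ r := by gcongr
      _ = 1 * (r * M) ^ r := by rw [mul_pow, one_mul]
      _ ≤ (d + 1) * (r * M) ^ r := by
        gcongr
        omega
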